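/- Ungatherability of class I₄ configurations (paper's Corollary 1, fully synchronous version): let (R₀, M) be a configuration and φ a grid automorphism with φ(M) = M, with the image multiset of R₀ under φ equal to R₀, and such that no meeting node is fixed by φ (φ(m) ≠ m for all m ∈ M). Then in the fully synchronous execution of any equivariant deterministic anonymous algorithm F, at no round t are all robots located at a single meeting node; i.e., the gathering over meeting nodes problem is unsolvable. This applies in particular when φ is a reflection across a line of symmetry containing no robots or meeting nodes, or a rotation whose center carries no robot or meeting node. -/

import Mathlib

/-- Manhattan distance on the integer grid. -/
def mdist (u v : ℤ × ℤ) : ℤ := |u.1 - v.1| + |u.2 - v.2|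

/-- Adjacency in the infinite grid graph. -/
def GridAdj (u v : ℤ × ℤ) : Prop := mdist u v = 1

/-- A grid automorphism: a bijection preserving adjacency in both directions. -/
def GridAuto (φ : ℤ × ℤ → ℤ × ℤ) : Prop :=
  Function.Bijective φ ∧ ∀ u v, GridAdj u v ↔ GridAdj (φ u) (φ v)

/-- The label function of a configuration (R, M). -/
def label (R : Multiset (ℤ × ℤ)) (M : Finset (ℤ × ℤ)) (v : ℤ × ℤ) : Fin 6 :=
  if v ∈ M then
    (if R.count v = 0 then 1 else if R.count v = 1 then 2 else 3)
  else
    (if R.count v = 0 then 0 else if R.count v = 1 then 4 else 5)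

/-- An equivariant deterministic anonymous algorithm. -/
def Equivariant (F : ((ℤ × ℤ) → Fin 6) → (ℤ × ℤ) → ℤ × ℤ) : Prop :=
  ∀ ψ : (ℤ × ℤ) ≃ (ℤ × ℤ), GridAuto ⇑ψ →
    ∀ (l : (ℤ × ℤ) → Fin 6) (v : ℤ × ℤ), F (l ∘ ⇑ψ.symm) (ψ v) = ψ (F l v)

/-- The fully synchronous execution of algorithm F from initial robot multiset R0. -/
def execF (F : ((ℤ × ℤ) → Fin 6) → (ℤ × ℤ) → ℤ × ℤ) (M : Finset (ℤ × ℤ))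
    (R0 : Multiset (ℤ × ℤ)) : ℕ → Multiset (ℤ × ℤ)
  | 0 => R0
  | t + 1 => (execF F M R0 t).map (F (label (execF F M R0 t) M))

/-- A symmetry of a configuration preserves its label function. -/
lemma label_comp_symm_of_map_eq {R : Multiset (ℤ × ℤ)} {M : Finset (ℤ × ℤ)}
    {φ : (ℤ × ℤ) ≃ (ℤ × ℤ)} (hM : M.image ⇑φ = M) (hR : R.map ⇑φ = R) :
    label R M ∘ ⇑φ.symm = label R M := by
  funext v
  have hmem : φ.symm v ∈ M ↔ v ∈ M := by
    conv_rhs => rw [← hM, ← φ.apply_symm_apply v, φ.injective.mem_finset_image]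
  have hcount : R.count (φ.symm v) = R.count v := by
    conv_rhs => rw [← hR, ← φ.apply_symm_apply v, Multiset.count_map_eq_count' _ _ φ.injective]
  simp only [Function.comp_apply, label, hmem, hcount]

/-- A symmetry of the initial configuration remains a symmetry throughout the execution. -/
lemma map_execF_eq {R0 : Multiset (ℤ × ℤ)} {M : Finset (ℤ × ℤ)}
    {φ : (ℤ × ℤ) ≃ (ℤ × ℤ)} (hφ : GridAuto ⇑φ) (hM : M.image ⇑φ = M)
    (hR : R0.map ⇑φ = R0) {F : ((ℤ × ℤ) → Fin 6) → (ℤ × ℤ) → ℤ × ℤ}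
    (hF : Equivariant F) (t : ℕ) : (execF F M R0 t).map ⇑φ = execF F M R0 t := by
  induction t with
  | zero => exact hR
  | succ t ih =>
    simp only [execF]
    set R := execF F M R0 t
    have hcomm : ∀ v, φ (F (label R M) v) = F (label R M) (φ v) := fun v => by
      rw [← hF φ hφ, label_comp_symm_of_map_eq hM ih]
    calc (R.map (F (label R M))).map ⇑φ = (R.map ⇑φ).map (F (label R M)) := by
          simp only [Multiset.map_map, Function.comp_def, hcomm]
      _ = R.map (F (label R M)) := by rw [ih]

/-- Ungatherability of class I₄ configurations: if a symmetry φ preserves the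
configuration and fixes no meeting node, then no equivariant deterministic
algorithm ever gathers all robots at a single meeting node. -/
theorem ungatherable_of_no_fixed_meeting_node (R0 : Multiset (ℤ × ℤ))
    (hR0 : R0 ≠ 0) (M : Finset (ℤ × ℤ)) (φ : (ℤ × ℤ) ≃ (ℤ × ℤ))
    (hφ : GridAuto ⇑φ) (hM : M.image ⇑φ = M) (hR : R0.map ⇑φ = R0)
    (hnofix : ∀ m ∈ M, φ m ≠ m)
    (F : ((ℤ × ℤ) → Fin 6) → (ℤ × ℤ) → ℤ × ℤ) (hF : Equivariant F) :
    ∀ t : ℕ, ¬ ∃ m ∈ M, execF F M R0 t = Multiset.replicate (Multiset.card R0) m := by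
  rintro t ⟨m, hm, ht⟩
  have hfix := map_execF_eq hφ hM hR hF t
  rw [ht, Multiset.map_replicate] at hfix
  exact hnofix m hm (Multiset.replicate_right_injective (by simpa using hR0) hfix)
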